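/- arXiv:2403.18970 — 3 statements merged into one kernel-verified Lean document; each statement's English description precedes it below -/
import Mathlib

section
/- Let A be a symmetric positive definite real n×n matrix and, for k = 0, 1, …, N, let R_k be a real n_k×n matrix of full row rank, so that each matrix A_k = R_k A R_kᵀ is symmetric positive definite. Define M⁻¹ = Σ_{k=0}^N R_kᵀ A_k⁻¹ R_k. Assume: (i) stable decomposition with constant C_0 > 0: every u ∈ ℝ^n admits a decomposition u = Σ_{k=0}^N R_kᵀ u_k with u_k ∈ ℝ^{n_k} such that Σ_{k=0}^N (R_kᵀ u_k)ᵀ A (R_kᵀ u_k) ≤ C_0² · uᵀ A u; and (ii) strengthened coloring bound with constant N_c > 0: for all choices u_k ∈ ℝ^{n_k}, 1 ≤ k ≤ N, one has (Σ_{k=1}^N R_kᵀ u_k)ᵀ A (Σ_{k=1}^N R_kᵀ u_k) ≤ N_c · Σ_{k=1}^N (R_kᵀ u_k)ᵀ A (R_kᵀ u_k). Then every complex eigenvalue μ of the matrix M⁻¹A is real and satisfies C_0⁻² ≤ μ ≤ N_c + 1; consequently the condition number of M⁻¹A, i.e., the ratio of its largest to its smallest eigenvalue, is at most C_0²(N_c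 + 1). -/
open Matrix

/-- Symmetry of the bilinear form of a real symmetric matrix. -/
theorem dotProduct_mulVec_comm_of_isSymm {n : Type*} [Fintype n] {A : Matrix n n ℝ}
    (hA : A.IsSymm) (x y : n → ℝ) : x ⬝ᵥ (A *ᵥ y) = y ⬝ᵥ (A *ᵥ x) := by
  rw [dotProduct_mulVec, ← mulVec_transpose, hA.eq, dotProduct_comm]

theorem Matrix.PosSemidef.isSymm_real {n : Type*} {A : Matrix n n ℝ}
    (hA : A.PosSemidef) : A.IsSymm := by
  simpa [IsSymm, IsHermitian, conjTranspose_eq_transpose_of_trivial] using hA.isHermitian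

/-- Young's inequality for the bilinear form of a positive semidefinite matrix. -/
theorem Matrix.PosSemidef.two_mul_dotProduct_le {n : Type*} [Fintype n] {A : Matrix n n ℝ}
    (hA : A.PosSemidef) (t : ℝ) (x y : n → ℝ) :
    2 * t * (x ⬝ᵥ (A *ᵥ y)) ≤ t ^ 2 * (x ⬝ᵥ (A *ᵥ x)) + y ⬝ᵥ (A *ᵥ y) := by
  have h : 0 ≤ (t • x - y) ⬝ᵥ (A *ᵥ (t • x - y)) := by
    simpa using hA.dotProduct_mulVec_nonneg (t • x - y)
  have hs := dotProduct_mulVec_comm_of_isSymm hA.isSymm_real x y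
  simp only [mulVec_sub, mulVec_smul, sub_dotProduct, dotProduct_sub, smul_dotProduct,
    dotProduct_smul, smul_eq_mul] at h
  rw [← hs] at h
  linarith

/-- The Galerkin matrix of a positive definite matrix on a full-rank subspace is positive
definite. -/
theorem Matrix.PosDef.mul_mul_transpose_of_rank_eq {n : Type*} [Fintype n] {m : ℕ}
    {A : Matrix n n ℝ} (hA : A.PosDef) {R : Matrix (Fin m) n ℝ} (hR : R.rank = m) :
    (R * A * Rᵀ).PosDef := by
  have hli : LinearIndependent ℝ R.row := by
    rw [linearIndependent_iff_card_eq_finrank_span, Fintype.card_fin, Set.finrank,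
      ← rank_eq_finrank_span_row, hR]
  have h := hA.mul_mul_conjTranspose_same (B := R) (vecMul_injective_iff.2 hli)
  rwa [conjTranspose_eq_transpose_of_trivial] at h

/-- `Rᵀ (R A Rᵀ)⁻¹ R A` acts as the `A`-orthogonal projection onto the range of `Rᵀ`. -/
theorem galerkin_orthogonality {n : Type*} [Fintype n] {m : ℕ}
    {A : Matrix n n ℝ} (hA : A.PosDef) {R : Matrix (Fin m) n ℝ} (hR : R.rank = m)
    (z : Fin m → ℝ) (u : n → ℝ) :
    (Rᵀ *ᵥ z) ⬝ᵥ (A *ᵥ (Rᵀ *ᵥ ((R * A * Rᵀ)⁻¹ *ᵥ (R *ᵥ (A *ᵥ u))))) =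
      (Rᵀ *ᵥ z) ⬝ᵥ (A *ᵥ u) := by
  have hdet : IsUnit (R * A * Rᵀ).det :=
    (hA.mul_mul_transpose_of_rank_eq hR).det_pos.ne'.isUnit
  have key (w : n → ℝ) : (Rᵀ *ᵥ z) ⬝ᵥ w = z ⬝ᵥ (R *ᵥ w) := by
    rw [mulVec_transpose, dotProduct_mulVec]
  rw [key, key, mulVec_mulVec, mulVec_mulVec, mulVec_mulVec,
    mul_nonsing_inv _ hdet, one_mulVec]

/-- Eigenvalue bounds for a sum of `A`-orthogonal projections onto the ranges of `R kᵀ`. -/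
theorem schwarz_eigenvalue_bounds {n ι : Type*} [Fintype n] [Fintype ι] [DecidableEq ι] (i₀ : ι)
    {A : Matrix n n ℝ} (hA : A.PosDef)
    {nk : ι → ℕ} {R : ∀ k, Matrix (Fin (nk k)) n ℝ} (hR : ∀ k, (R k).rank = nk k)
    {C0 Nc : ℝ} (hC0 : 0 < C0) (hNc : 0 < Nc)
    (hstable : ∀ u : n → ℝ, ∃ uk : ∀ k, Fin (nk k) → ℝ,
      (u = ∑ k, (R k)ᵀ *ᵥ uk k) ∧
      (∑ k, ((R k)ᵀ *ᵥ uk k) ⬝ᵥ (A *ᵥ ((R k)ᵀ *ᵥ uk k)) ≤ C0 ^ 2 * (u ⬝ᵥ (A *ᵥ u))))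
    (hcolor : ∀ uk : ∀ k, Fin (nk k) → ℝ,
      (∑ k ∈ Finset.univ.erase i₀, (R k)ᵀ *ᵥ uk k) ⬝ᵥ
          (A *ᵥ (∑ k ∈ Finset.univ.erase i₀, (R k)ᵀ *ᵥ uk k)) ≤
        Nc * ∑ k ∈ Finset.univ.erase i₀, ((R k)ᵀ *ᵥ uk k) ⬝ᵥ (A *ᵥ ((R k)ᵀ *ᵥ uk k)))
    {u : n → ℝ} (hu : u ≠ 0) {r : ℝ}
    (hr : ((∑ k, (R k)ᵀ * (R k * A * (R k)ᵀ)⁻¹ * R k) * A) *ᵥ u = r • u) :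
    (C0 ^ 2)⁻¹ ≤ r ∧ r ≤ Nc + 1 := by
  have hu_pos : 0 < u ⬝ᵥ (A *ᵥ u) := by simpa using hA.dotProduct_mulVec_pos hu
  set c : ∀ k, Fin (nk k) → ℝ := fun k => (R k * A * (R k)ᵀ)⁻¹ *ᵥ (R k *ᵥ (A *ᵥ u)) with hc
  set p : ι → n → ℝ := fun k => (R k)ᵀ *ᵥ c k with hp
  have hproj (k : ι) (z : Fin (nk k) → ℝ) :
      ((R k)ᵀ *ᵥ z) ⬝ᵥ (A *ᵥ p k) = ((R k)ᵀ *ᵥ z) ⬝ᵥ (A *ᵥ u) :=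
    galerkin_orthogonality hA (hR k) z u
  have hsum : ∑ k, p k = r • u := by
    rw [← hr, ← mulVec_mulVec, sum_mulVec]
    simp only [hp, hc, mulVec_mulVec, Matrix.mul_assoc]
  have henergy : ∑ k, p k ⬝ᵥ (A *ᵥ p k) = r * (u ⬝ᵥ (A *ᵥ u)) := by
    rw [Finset.sum_congr rfl fun k _ => hproj k (c k), ← sum_dotProduct, hsum, smul_dotProduct,
      smul_eq_mul]
  have hC : 0 < C0 ^ 2 := by positivity
  constructor
  · obtain ⟨w, hw, hwle⟩ := hstable u
    have hself : u ⬝ᵥ (A *ᵥ u) = ∑ k, ((R k)ᵀ *ᵥ w k) ⬝ᵥ (A *ᵥ p k) := by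
      simp only [hproj]
      rw [← sum_dotProduct, ← hw]
    have hyoung := Finset.sum_le_sum fun k (_ : k ∈ Finset.univ) =>
      hA.posSemidef.two_mul_dotProduct_le (C0 ^ 2)⁻¹ ((R k)ᵀ *ᵥ w k) (p k)
    rw [← Finset.mul_sum, ← hself, Finset.sum_add_distrib, ← Finset.mul_sum, henergy] at hyoung
    have hscaled := mul_le_mul_of_nonneg_left hwle (sq_nonneg (C0 ^ 2)⁻¹)
    have hcancel : ((C0 ^ 2)⁻¹) ^ 2 * (C0 ^ 2 * (u ⬝ᵥ (A *ᵥ u))) =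
        (C0 ^ 2)⁻¹ * (u ⬝ᵥ (A *ᵥ u)) := by
      field_simp
    refine le_of_mul_le_mul_right ?_ hu_pos
    linarith
  · set s : n → ℝ := ∑ k ∈ Finset.univ.erase i₀, p k with hs
    have hsplit : p i₀ + s = r • u := by
      rw [← hsum, hs, Finset.add_sum_erase _ _ (Finset.mem_univ i₀)]
    have hcol : s ⬝ᵥ (A *ᵥ s) ≤ Nc * ∑ k ∈ Finset.univ.erase i₀, p k ⬝ᵥ (A *ᵥ p k) := hcolor c
    have henergy_split := Finset.add_sum_erase Finset.univ (fun k => p k ⬝ᵥ (A *ᵥ p k))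
      (Finset.mem_univ i₀)
    rw [henergy] at henergy_split
    have hyoung := hA.posSemidef.two_mul_dotProduct_le Nc (p i₀) s
    have hexpand : r ^ 2 * (u ⬝ᵥ (A *ᵥ u)) =
        p i₀ ⬝ᵥ (A *ᵥ p i₀) + 2 * (p i₀ ⬝ᵥ (A *ᵥ s)) + s ⬝ᵥ (A *ᵥ s) := by
      have h : (r • u) ⬝ᵥ (A *ᵥ (r • u)) = (p i₀ + s) ⬝ᵥ (A *ᵥ (p i₀ + s)) := by rw [hsplit]
      simp only [mulVec_add, mulVec_smul, add_dotProduct, dotProduct_add, smul_dotProduct,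
        dotProduct_smul, smul_eq_mul] at h
      rw [dotProduct_mulVec_comm_of_isSymm hA.posSemidef.isSymm_real s (p i₀)] at h
      linarith
    have hmain : Nc * (r ^ 2 * (u ⬝ᵥ (A *ᵥ u))) ≤
        Nc * ((Nc + 1) * (r * (u ⬝ᵥ (A *ᵥ u)))) := by
      rw [hexpand, ← henergy_split]
      nlinarith [mul_le_mul_of_nonneg_left hcol (by linarith : 0 ≤ Nc + 1)]
    have hle := le_of_mul_le_mul_left hmain hNc
    have hr_nonneg : 0 ≤ r := by
      refine nonneg_of_mul_nonneg_left (b := u ⬝ᵥ (A *ᵥ u)) ?_ hu_pos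
      rw [← henergy]
      exact Finset.sum_nonneg fun k _ => by
        simpa using hA.posSemidef.dotProduct_mulVec_nonneg (p k)
    rcases hr_nonneg.eq_or_lt with h0 | hpos
    · linarith
    · refine le_of_mul_le_mul_right ?_ (mul_pos hpos hu_pos)
      linarith

/-- If `A` is positive definite and `A * T` is symmetric, every complex eigenvalue of the real
matrix `T` is real and has a real eigenvector. -/
theorem exists_real_eigenvector_of_mem_spectrum_map {n : Type*} [Fintype n] [DecidableEq n]
    {A T : Matrix n n ℝ} (hA : A.PosDef) (hT : (A * T).IsSymm) {μ : ℂ}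
    (hμ : μ ∈ spectrum ℂ (T.map Complex.ofReal)) :
    ∃ r : ℝ, μ = r ∧ ∃ u : n → ℝ, u ≠ 0 ∧ T *ᵥ u = r • u := by
  rw [← spectrum_toLin', ← Module.End.hasEigenvalue_iff_mem_spectrum] at hμ
  obtain ⟨v, hv⟩ := hμ.exists_hasEigenvector
  have hv0 := hv.2
  have hTv : T.map Complex.ofReal *ᵥ v = μ • v := by simpa using hv.apply_eq_smul
  set x : n → ℝ := fun i => (v i).re with hx
  set y : n → ℝ := fun i => (v i).im with hy
  have hTx : T *ᵥ x = μ.re • x - μ.im • y := by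
    ext i
    simpa [mulVec, dotProduct, hx, hy] using congrArg Complex.re (congrFun hTv i)
  have hTy : T *ᵥ y = μ.re • y + μ.im • x := by
    ext i
    simpa [mulVec, dotProduct, hx, hy] using congrArg Complex.im (congrFun hTv i)
  have hxy : x ≠ 0 ∨ y ≠ 0 := by
    by_contra! h
    exact hv0 (funext fun i => Complex.ext (congrFun h.1 i) (congrFun h.2 i))
  have hx_nonneg : 0 ≤ x ⬝ᵥ (A *ᵥ x) := by simpa using hA.posSemidef.dotProduct_mulVec_nonneg x
  have hy_nonneg : 0 ≤ y ⬝ᵥ (A *ᵥ y) := by simpa using hA.posSemidef.dotProduct_mulVec_nonneg y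
  have hpos : 0 < x ⬝ᵥ (A *ᵥ x) + y ⬝ᵥ (A *ᵥ y) := by
    rcases hxy with h | h
    · have : 0 < x ⬝ᵥ (A *ᵥ x) := by simpa using hA.dotProduct_mulVec_pos h
      linarith
    · have : 0 < y ⬝ᵥ (A *ᵥ y) := by simpa using hA.dotProduct_mulVec_pos h
      linarith
  have him : μ.im = 0 := by
    have h := dotProduct_mulVec_comm_of_isSymm hT x y
    simp only [← mulVec_mulVec, hTx, hTy, mulVec_add, mulVec_sub, mulVec_smul, dotProduct_add,
      dotProduct_sub, dotProduct_smul, smul_eq_mul] at h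
    rw [dotProduct_mulVec_comm_of_isSymm hA.posSemidef.isSymm_real y x] at h
    have h0 : μ.im * (x ⬝ᵥ (A *ᵥ x) + y ⬝ᵥ (A *ᵥ y)) = 0 := by linarith
    exact (mul_eq_zero.1 h0).resolve_right hpos.ne'
  refine ⟨μ.re, Complex.ext rfl (by simpa using him), ?_⟩
  rcases hxy with h | h
  · exact ⟨x, h, by simpa [him] using hTx⟩
  · exact ⟨y, h, by simpa [him] using hTy⟩

/-- abstract additive Schwarz condition number estimate. Under the stable
decomposition assumption (constant `C₀`) and the strengthened coloring assumption
(constant `N_c`), every complex eigenvalue `μ` of `M⁻¹A` is real with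
`C₀⁻² ≤ μ ≤ N_c + 1`; consequently the ratio of any two eigenvalues of `M⁻¹A` is at most
`C₀²(N_c + 1)`. -/
theorem stmt_3 (n N : ℕ) (A : Matrix (Fin n) (Fin n) ℝ) (hA : A.PosDef)
    (nk : Fin (N + 1) → ℕ) (R : ∀ k, Matrix (Fin (nk k)) (Fin n) ℝ)
    (hR : ∀ k, (R k).rank = nk k)
    (C0 Nc : ℝ) (hC0 : 0 < C0) (hNc : 0 < Nc)
    (hstable : ∀ u : Fin n → ℝ, ∃ uk : ∀ k, Fin (nk k) → ℝ,
      (u = ∑ k, (R k)ᵀ *ᵥ uk k) ∧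
      (∑ k, ((R k)ᵀ *ᵥ uk k) ⬝ᵥ (A *ᵥ ((R k)ᵀ *ᵥ uk k)) ≤ C0 ^ 2 * (u ⬝ᵥ (A *ᵥ u))))
    (hcolor : ∀ uk : ∀ k, Fin (nk k) → ℝ,
      (∑ k ∈ Finset.univ.erase (0 : Fin (N + 1)), (R k)ᵀ *ᵥ uk k) ⬝ᵥ
          (A *ᵥ (∑ k ∈ Finset.univ.erase (0 : Fin (N + 1)), (R k)ᵀ *ᵥ uk k)) ≤
        Nc * ∑ k ∈ Finset.univ.erase (0 : Fin (N + 1)),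
          ((R k)ᵀ *ᵥ uk k) ⬝ᵥ (A *ᵥ ((R k)ᵀ *ᵥ uk k))) :
    (∀ μ : ℂ,
        μ ∈ spectrum ℂ
          (((∑ k, (R k)ᵀ * (R k * A * (R k)ᵀ)⁻¹ * R k) * A).map (Complex.ofReal)) →
        ∃ r : ℝ, μ = (r : ℂ) ∧ (C0 ^ 2)⁻¹ ≤ r ∧ r ≤ Nc + 1) ∧
      (∀ μ₁ μ₂ : ℝ,
        μ₁ ∈ spectrum ℝ ((∑ k, (R k)ᵀ * (R k * A * (R k)ᵀ)⁻¹ * R k) * A) →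
        μ₂ ∈ spectrum ℝ ((∑ k, (R k)ᵀ * (R k * A * (R k)ᵀ)⁻¹ * R k) * A) →
        μ₁ / μ₂ ≤ C0 ^ 2 * (Nc + 1)) := by
  set T := (∑ k, (R k)ᵀ * (R k * A * (R k)ᵀ)⁻¹ * R k) * A with hTdef
  have hA_symm : A.IsSymm := hA.posSemidef.isSymm_real
  have hT : (A * T).IsSymm := by
    simp only [IsSymm, hTdef, transpose_mul, transpose_sum, transpose_nonsing_inv,
      transpose_transpose, hA_symm.eq, Matrix.mul_assoc]
  constructor
  · intro μ hμ
    obtain ⟨r, hr, u, hu, hTu⟩ := exists_real_eigenvector_of_mem_spectrum_map hA hT hμ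
    exact ⟨r, hr, schwarz_eigenvalue_bounds 0 hA hR hC0 hNc hstable hcolor hu hTu⟩
  · have hbounds (μ : ℝ) (hμ : μ ∈ spectrum ℝ T) : (C0 ^ 2)⁻¹ ≤ μ ∧ μ ≤ Nc + 1 := by
      rw [← spectrum_toLin', ← Module.End.hasEigenvalue_iff_mem_spectrum] at hμ
      obtain ⟨u, hu⟩ := hμ.exists_hasEigenvector
      exact schwarz_eigenvalue_bounds 0 hA hR hC0 hNc hstable hcolor hu.2
        (by simpa using hu.apply_eq_smul)
    intro μ₁ μ₂ h₁ h₂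
    have hinv : 0 < (C0 ^ 2)⁻¹ := by positivity
    calc μ₁ / μ₂ ≤ (Nc + 1) / (C0 ^ 2)⁻¹ :=
          div_le_div₀ (by linarith) (hbounds μ₁ h₁).2 hinv (hbounds μ₂ h₂).1
      _ = C0 ^ 2 * (Nc + 1) := by rw [div_inv_eq_mul, mul_comm]
end

section
/- Let A be a symmetric positive definite real n×n matrix and, for k = 0, 1, …, N, let R_k be a real n_k×n matrix of full row rank, so that each matrix A_k = R_k A R_kᵀ is symmetric positive definite. Define M⁻¹ = Σ_{k=0}^N R_kᵀ A_k⁻¹ R_k. Suppose there is a constant C_0 > 0 such that every u ∈ ℝ^n admits a decomposition u = Σ_{k=0}^N R_kᵀ u_k with u_k ∈ ℝ^{n_k} satisfying Σ_{k=0}^N (R_kᵀ u_k)ᵀ A (R_kᵀ u_k) ≤ C_0² · uᵀ A u. Then for every u ∈ ℝ^n, uᵀ A u ≤ C_0² · uᵀ A M⁻¹ A u. -/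
open Matrix

/-- Young's inequality for the dual pair of norms defined by a positive definite matrix and its
inverse. -/
theorem Matrix.PosDef.two_mul_dotProduct_le {m : Type*} [Fintype m] [DecidableEq m]
    {B : Matrix m m ℝ} (hB : B.PosDef) (t : ℝ) (w v : m → ℝ) :
    2 * t * (w ⬝ᵥ v) ≤ t ^ 2 * (w ⬝ᵥ (B⁻¹ *ᵥ w)) + v ⬝ᵥ (B *ᵥ v) := by
  have hdet : IsUnit B.det := hB.det_pos.ne'.isUnit
  have hBT : Bᵀ = B := by simpa using hB.isHermitian.eq
  have hBz : B *ᵥ (B⁻¹ *ᵥ w) = w := by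
    rw [mulVec_mulVec, mul_nonsing_inv B hdet, one_mulVec]
  have hzv : (B⁻¹ *ᵥ w) ⬝ᵥ (B *ᵥ v) = w ⬝ᵥ v := by
    rw [dotProduct_mulVec, ← mulVec_transpose, hBT, hBz]
  have h := hB.posSemidef.dotProduct_mulVec_nonneg (v - t • (B⁻¹ *ᵥ w))
  simp only [star_trivial, mulVec_sub, mulVec_smul, hBz, sub_dotProduct, dotProduct_sub,
    smul_dotProduct, dotProduct_smul, hzv, smul_eq_mul] at h
  rw [dotProduct_comm v w, dotProduct_comm _ w] at h
  linarith

/-- The Galerkin product `R A Rᵀ` is positive definite if `A` is and `R` has full row rank. -/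
theorem Matrix.PosDef.mul_mul_transpose_of_rank {m n : Type*} [Fintype m] [Fintype n]
    {A : Matrix n n ℝ} (hA : A.PosDef) {R : Matrix m n ℝ} (hR : R.rank = Fintype.card m) :
    (R * A * Rᵀ).PosDef := by
  have hrow : LinearIndependent ℝ R.row := by
    rw [linearIndependent_iff_card_eq_finrank_span, Set.finrank, ← rank_eq_finrank_span_row, hR]
  simpa using hA.mul_mul_conjTranspose_same (vecMul_injective_iff.mpr hrow)

/-- lower bound for the additive Schwarz preconditioned operator
(P. L. Lions' lemma): the stable decomposition assumption with constant `C₀` implies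
`uᵀ A u ≤ C₀² · uᵀ A M⁻¹ A u` for every `u`. -/
theorem stmt_4 (n N : ℕ) (A : Matrix (Fin n) (Fin n) ℝ) (hA : A.PosDef)
    (nk : Fin (N + 1) → ℕ) (R : ∀ k, Matrix (Fin (nk k)) (Fin n) ℝ)
    (hR : ∀ k, (R k).rank = nk k)
    (C0 : ℝ) (hC0 : 0 < C0)
    (hstable : ∀ u : Fin n → ℝ, ∃ uk : ∀ k, Fin (nk k) → ℝ,
      (u = ∑ k, (R k)ᵀ *ᵥ uk k) ∧
      (∑ k, ((R k)ᵀ *ᵥ uk k) ⬝ᵥ (A *ᵥ ((R k)ᵀ *ᵥ uk k)) ≤ C0 ^ 2 * (u ⬝ᵥ (A *ᵥ u)))) :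
    ∀ u : Fin n → ℝ,
      u ⬝ᵥ (A *ᵥ u) ≤
        C0 ^ 2 *
          (u ⬝ᵥ (A *ᵥ ((∑ k, (R k)ᵀ * (R k * A * (R k)ᵀ)⁻¹ * R k) *ᵥ (A *ᵥ u)))) := by
  intro u
  obtain ⟨v, hu, hv⟩ := hstable u
  have hAT : Aᵀ = A := by simpa using hA.isHermitian.eq
  have hsymm (y : Fin n → ℝ) : u ⬝ᵥ (A *ᵥ y) = (A *ᵥ u) ⬝ᵥ y := by
    rw [dotProduct_mulVec, ← mulVec_transpose, hAT]
  have henergy : u ⬝ᵥ (A *ᵥ u) = ∑ k, (R k *ᵥ (A *ᵥ u)) ⬝ᵥ v k := by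
    calc u ⬝ᵥ (A *ᵥ u) = (A *ᵥ u) ⬝ᵥ ∑ k, (R k)ᵀ *ᵥ v k := by rw [← hu, hsymm]
      _ = _ := by
        rw [dotProduct_sum]
        refine Finset.sum_congr rfl fun k _ => ?_
        rw [dotProduct_mulVec, vecMul_transpose]
  have hprec : u ⬝ᵥ (A *ᵥ ((∑ k, (R k)ᵀ * (R k * A * (R k)ᵀ)⁻¹ * R k) *ᵥ (A *ᵥ u))) =
      ∑ k, (R k *ᵥ (A *ᵥ u)) ⬝ᵥ ((R k * A * (R k)ᵀ)⁻¹ *ᵥ (R k *ᵥ (A *ᵥ u))) := by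
    rw [hsymm, sum_mulVec, dotProduct_sum]
    refine Finset.sum_congr rfl fun k _ => ?_
    rw [← mulVec_mulVec, ← mulVec_mulVec, dotProduct_mulVec, vecMul_transpose]
  have hlocal (k : Fin (N + 1)) : ((R k)ᵀ *ᵥ v k) ⬝ᵥ (A *ᵥ ((R k)ᵀ *ᵥ v k)) =
      v k ⬝ᵥ ((R k * A * (R k)ᵀ) *ᵥ v k) := by
    rw [← mulVec_mulVec, ← mulVec_mulVec, dotProduct_mulVec (v k), mulVec_transpose]
  have hsum := Finset.sum_le_sum fun k (_ : k ∈ Finset.univ) =>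
    (hA.mul_mul_transpose_of_rank (R := R k) (by simpa using hR k)).two_mul_dotProduct_le
      (C0 ^ 2) (R k *ᵥ (A *ᵥ u)) (v k)
  simp only [← hlocal] at hsum
  rw [Finset.sum_add_distrib, ← Finset.mul_sum, ← Finset.mul_sum, ← henergy, ← hprec] at hsum
  refine le_of_mul_le_mul_left ?_ (pow_pos hC0 2)
  linarith
end

section
/- Let A be a symmetric positive definite real n×n matrix and, for k = 0, 1, …, N, let R_k be a real n_k×n matrix of full row rank, so that each matrix A_k = R_k A R_kᵀ is symmetric positive definite. Define M⁻¹ = Σ_{k=0}^N R_kᵀ A_k⁻¹ R_k. Suppose there is a constant N_c > 0 such that for all choices u_k ∈ ℝ^{n_k}, 1 ≤ k ≤ N, one has (Σ_{k=1}^N R_kᵀ u_k)ᵀ A (Σ_{k=1}^N R_kᵀ u_k) ≤ N_c · Σ_{k=1}^N (R_kᵀ u_k)ᵀ A (R_kᵀ u_k). Then for every u ∈ ℝ^n, uᵀ A M⁻¹ A u ≤ (N_c + 1) · uᵀ A u. -/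
open Matrix

/-- For a positive semidefinite form `a`, `a(v, v) ≤ c a(u, v)` implies `a(u, v) ≤ c a(u, u)`. -/
theorem Matrix.PosSemidef.dotProduct_mulVec_le_mul_self {ι : Type*} [Fintype ι]
    {A : Matrix ι ι ℝ} (hA : A.PosSemidef) {u v : ι → ℝ} {c : ℝ} (hc : 0 < c)
    (h : v ⬝ᵥ (A *ᵥ v) ≤ c * (u ⬝ᵥ (A *ᵥ v))) :
    u ⬝ᵥ (A *ᵥ v) ≤ c * (u ⬝ᵥ (A *ᵥ u)) := by
  have hT : Aᵀ = A := by simpa [IsHermitian] using hA.isHermitian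
  have hsymm : v ⬝ᵥ (A *ᵥ u) = u ⬝ᵥ (A *ᵥ v) := by
    rw [dotProduct_comm, dotProduct_mulVec, ← mulVec_transpose, hT]
  have h0 : 0 ≤ (c • u - v) ⬝ᵥ (A *ᵥ (c • u - v)) := by
    simpa using hA.dotProduct_mulVec_nonneg (c • u - v)
  simp only [mulVec_sub, mulVec_smul, sub_dotProduct, dotProduct_sub, smul_dotProduct,
    dotProduct_smul, smul_eq_mul, hsymm] at h0
  refine le_of_mul_le_mul_left ?_ hc
  linarith

/-- The subspace correction `p = Rᵀ (R A Rᵀ)⁻¹ R A u` satisfies `a(p, p) = a(u, p)`. -/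
theorem Matrix.IsSymm.dotProduct_mulVec_subspaceCorrection {ι κ : Type*} [Fintype ι] [Fintype κ]
    [DecidableEq κ] {A : Matrix ι ι ℝ} (hA : A.IsSymm) (R : Matrix κ ι ℝ) (u : ι → ℝ) :
    ((Rᵀ * (R * A * Rᵀ)⁻¹ * R) *ᵥ (A *ᵥ u)) ⬝ᵥ
        (A *ᵥ ((Rᵀ * (R * A * Rᵀ)⁻¹ * R) *ᵥ (A *ᵥ u))) =
      u ⬝ᵥ (A *ᵥ ((Rᵀ * (R * A * Rᵀ)⁻¹ * R) *ᵥ (A *ᵥ u))) := by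
  have hinv : (R * A * Rᵀ)⁻¹ * (R * A * Rᵀ) * (R * A * Rᵀ)⁻¹ = (R * A * Rᵀ)⁻¹ := by
    by_cases h : IsUnit (R * A * Rᵀ).det
    · rw [nonsing_inv_mul _ h, Matrix.one_mul]
    · simp [nonsing_inv_apply_not_isUnit _ h]
  have hBT : (Rᵀ * (R * A * Rᵀ)⁻¹ * R)ᵀ = Rᵀ * (R * A * Rᵀ)⁻¹ * R := by
    simp [transpose_mul, transpose_nonsing_inv, hA.eq, Matrix.mul_assoc]
  have hBAB : (Rᵀ * (R * A * Rᵀ)⁻¹ * R) * A * (Rᵀ * (R * A * Rᵀ)⁻¹ * R) =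
      Rᵀ * (R * A * Rᵀ)⁻¹ * R := by
    calc _ = Rᵀ * ((R * A * Rᵀ)⁻¹ * (R * A * Rᵀ) * (R * A * Rᵀ)⁻¹) * R := by
          simp only [Matrix.mul_assoc]
      _ = _ := by rw [hinv]
  generalize Rᵀ * (R * A * Rᵀ)⁻¹ * R = B at hBT hBAB ⊢
  have hswap {M : Matrix ι ι ℝ} (hM : Mᵀ = M) (x y : ι → ℝ) :
      (M *ᵥ x) ⬝ᵥ y = x ⬝ᵥ (M *ᵥ y) := by
    rw [dotProduct_mulVec, ← mulVec_transpose, hM]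
  rw [hswap hBT, hswap hA.eq]
  simp only [mulVec_mulVec, ← Matrix.mul_assoc]
  rw [Matrix.mul_assoc A B A, Matrix.mul_assoc A (B * A) B, hBAB, Matrix.mul_assoc]

/-- upper bound for the additive Schwarz preconditioned operator: the
strengthened coloring assumption with constant `N_c` for the local spaces `k = 1, …, N`
implies `uᵀ A M⁻¹ A u ≤ (N_c + 1) · uᵀ A u` for every `u`. -/
theorem stmt_5 (n N : ℕ) (A : Matrix (Fin n) (Fin n) ℝ) (hA : A.PosDef)
    (nk : Fin (N + 1) → ℕ) (R : ∀ k, Matrix (Fin (nk k)) (Fin n) ℝ)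
    (hR : ∀ k, (R k).rank = nk k)
    (Nc : ℝ) (hNc : 0 < Nc)
    (hcolor : ∀ uk : ∀ k, Fin (nk k) → ℝ,
      (∑ k ∈ Finset.univ.erase (0 : Fin (N + 1)), (R k)ᵀ *ᵥ uk k) ⬝ᵥ
          (A *ᵥ (∑ k ∈ Finset.univ.erase (0 : Fin (N + 1)), (R k)ᵀ *ᵥ uk k)) ≤
        Nc * ∑ k ∈ Finset.univ.erase (0 : Fin (N + 1)),
          ((R k)ᵀ *ᵥ uk k) ⬝ᵥ (A *ᵥ ((R k)ᵀ *ᵥ uk k))) :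
    ∀ u : Fin n → ℝ,
      u ⬝ᵥ (A *ᵥ ((∑ k, (R k)ᵀ * (R k * A * (R k)ᵀ)⁻¹ * R k) *ᵥ (A *ᵥ u))) ≤
        (Nc + 1) * (u ⬝ᵥ (A *ᵥ u)) := by
  intro u
  have hsymm : A.IsSymm := by simpa [IsHermitian, IsSymm] using hA.isHermitian
  set p : Fin (N + 1) → Fin n → ℝ := fun k =>
    ((R k)ᵀ * (R k * A * (R k)ᵀ)⁻¹ * R k) *ᵥ (A *ᵥ u)
  have hpp : ∀ k, p k ⬝ᵥ (A *ᵥ p k) = u ⬝ᵥ (A *ᵥ p k) := fun k =>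
    hsymm.dotProduct_mulVec_subspaceCorrection (R k) u
  have hlocal : u ⬝ᵥ (A *ᵥ ∑ k ∈ Finset.univ.erase 0, p k) ≤ Nc * (u ⬝ᵥ (A *ᵥ u)) := by
    refine hA.posSemidef.dotProduct_mulVec_le_mul_self hNc ?_
    have hRp : ∀ k, (R k)ᵀ *ᵥ (((R k * A * (R k)ᵀ)⁻¹ * R k) *ᵥ (A *ᵥ u)) = p k := fun k => by
      rw [mulVec_mulVec, ← Matrix.mul_assoc]
    have h := hcolor fun k => ((R k * A * (R k)ᵀ)⁻¹ * R k) *ᵥ (A *ᵥ u)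
    simp only [hRp, hpp] at h
    rwa [← dotProduct_sum, ← mulVec_sum] at h
  have hcoarse : u ⬝ᵥ (A *ᵥ p 0) ≤ 1 * (u ⬝ᵥ (A *ᵥ u)) :=
    hA.posSemidef.dotProduct_mulVec_le_mul_self one_pos (by rw [hpp, one_mul])
  rw [sum_mulVec, ← Finset.add_sum_erase _ _ (Finset.mem_univ 0), mulVec_add, dotProduct_add]
  linarith
end
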